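/- Let u = √3/2 and let A(31,2) be the arrangement of 31 lines in ℙ²(ℝ) consisting of: the ten lines defined by the linear forms x, x−uz, x+uz, x−2uz, x+2uz, x−3uz, x+3uz, y, y−z, y+z; the images of these ten lines under the rotations by 60° and 120° about (0:0:1); and the line z = 0. Let S' be the set of all points of ℙ²(ℝ) lying on at least two lines of A(31,2) (there are 127 such points) and let I' = ⋂_{P∈S'} I(P) ⊆ ℝ[x,y,z]. Then the containment I'^(3) = ⋂_{P∈S'} I(P)³ ⊆ I'² holds. -/

import Mathlib

open MvPolynomial

noncomputable section

/-- The polynomial ring `ℝ[x,y,z]`, with `x = X 0`, `y = X 1`, `z = X 2`. -/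
abbrev PolyR := MvPolynomial (Fin 3) ℝ

/-- `u = √3 / 2`. -/
def u : ℝ := Real.sqrt 3 / 2

/-- The rotation by 60° about `(0:0:1)`. -/
def rotA : Matrix (Fin 3) (Fin 3) ℝ := !![1/2, -u, 0; u, 1/2, 0; 0, 0, 1]

/-- Linear substitution of variables by a matrix `M`:  `(substMat M f)(v) = f(M v)`. -/
def substMat (M : Matrix (Fin 3) (Fin 3) ℝ) : PolyR →ₐ[ℝ] PolyR :=
  MvPolynomial.aeval fun i => ∑ j, MvPolynomial.C (M i j) * MvPolynomial.X j

/-- The ten initial linear forms of the arrangement `A(31,2)`: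
`x`, `x ∓ uz`, `x ∓ 2uz`, `x ∓ 3uz`, `y`, `y ∓ z`. -/
def baseForms312 : Fin 10 → PolyR :=
  ![X 0, X 0 - C u * X 2, X 0 + C u * X 2, X 0 - C (2*u) * X 2, X 0 + C (2*u) * X 2,
    X 0 - C (3*u) * X 2, X 0 + C (3*u) * X 2, X 1, X 1 - X 2, X 1 + X 2]

/-- The 31 linear forms defining the simplicial arrangement `A(31,2)`: the ten initial
forms, their images under the rotations by 60° and 120° about `(0:0:1)` (the image of a
line `{ℓ = 0}` under a matrix `M` being `{ℓ ∘ M⁻¹ = 0}`), and the line at infinity `z = 0`. -/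
def lines312 : Fin 31 → PolyR := fun i =>
  if h : (i : ℕ) < 10 then baseForms312 ⟨i, h⟩
  else if h2 : (i : ℕ) < 20 then substMat rotA⁻¹ (baseForms312 ⟨(i : ℕ) - 10, by omega⟩)
  else if h3 : (i : ℕ) < 30 then substMat (rotA ^ 2)⁻¹ (baseForms312 ⟨(i : ℕ) - 20, by omega⟩)
  else X 2

/-- The real projective plane `ℙ²(ℝ)`. -/
abbrev P2R := Projectivization ℝ (Fin 3 → ℝ)

open Classical in
/-- The number of lines of `A(31,2)` passing through a point `P ∈ ℙ²(ℝ)`. -/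
def mult312 (P : P2R) : ℕ :=
  (Finset.univ.filter fun i => MvPolynomial.eval (Projectivization.rep P) (lines312 i) = 0).card

/-- The set of intersection points of `A(31,2)`: points lying on at least two lines. -/
def S312 : Set P2R := {P | 2 ≤ mult312 P}

/-- The homogeneous vanishing ideal `I(P)` of the projective point spanned by `v`:
polynomials vanishing on the whole line `ℝ·v`. -/
def pointIdeal (v : Fin 3 → ℝ) : Ideal PolyR where
  carrier := {f | ∀ c : ℝ, MvPolynomial.eval (c • v) f = 0}
  zero_mem' := by intro c; simp
  add_mem' := by intro a b ha hb c; simp [ha c, hb c]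
  smul_mem' := by intro a f hf c; simp [smul_eq_mul, hf c]

end

abbrev V3 := Fin 3 → ℝ

noncomputable def lin (l : V3) : PolyR := ∑ i, C (l i) * X i

theorem eval_lin (l v : V3) : eval v (lin l) = ∑ i, l i * v i := by
  simp [lin]

theorem lin_hom (l : V3) : (lin l).IsHomogeneous 1 := by
  refine IsHomogeneous.sum _ _ _ fun i _ => ?_
  exact isHomogeneous_C_mul_X _ _

theorem hom_eval {f : PolyR} {n : ℕ} (hf : f.IsHomogeneous n) (c : ℝ) (v : V3) :
    eval (c • v) f = c ^ n * eval v f := by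
  rw [eval_eq, eval_eq, Finset.mul_sum]
  refine Finset.sum_congr rfl fun d hd => ?_
  have : ∑ i ∈ d.support, d i = n := hf.degree_eq_sum_deg_support hd |>.symm
  simp only [Pi.smul_apply, smul_eq_mul, mul_pow, Finset.prod_mul_distrib]
  rw [Finset.prod_pow_eq_pow_sum, this]; ring

theorem mem_pi_of_hom {f : PolyR} {n : ℕ} (hf : f.IsHomogeneous n) {v : V3}
    (h : eval v f = 0) : f ∈ pointIdeal v := by
  intro c
  rw [hom_eval hf, h, mul_zero]

theorem eval_of_mem_pi {f : PolyR} {v : V3} (h : f ∈ pointIdeal v) : eval v f = 0 := by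
  have := h 1
  simpa using this

theorem pderiv_sq {f : PolyR} {v : V3} (h : f ∈ pointIdeal v ^ 2) (j : Fin 3) :
    eval v (pderiv j f) = 0 := by
  rw [pow_two] at h
  refine Submodule.mul_induction_on h ?_ ?_
  · intro a ha b hb
    simp [Derivation.leibniz, eval_of_mem_pi ha, eval_of_mem_pi hb]
  · intro a b ha hb
    simp [ha, hb]

theorem pderiv_lin (l : V3) (j : Fin 3) : pderiv j (lin l) = C (l j) := by
  simp [lin, pderiv_X, Pi.single_apply, Derivation.leibniz]

theorem lin_exists {m : PolyR} (hm : m.IsHomogeneous 1) : ∃ c : V3, m = lin c := by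
  have : m ∈ homogeneousSubmodule (Fin 3) ℝ 1 := hm
  rw [homogeneousSubmodule_one_eq_span_X] at this
  rw [Submodule.mem_span_range_iff_exists_fun] at this
  obtain ⟨c, hc⟩ := this
  exact ⟨c, by rw [← hc]; simp [lin, smul_eq_C_mul]⟩

theorem hom_mul_ind {m n : ℕ} {Pr : PolyR → Prop}
    (hmul : ∀ p q : PolyR, p.IsHomogeneous m → q.IsHomogeneous n → Pr (p * q))
    (hadd : ∀ p q, Pr p → Pr q → Pr (p + q)) {f : PolyR} (hf : f.IsHomogeneous (m + n)) : Pr f := by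
  have : f ∈ homogeneousSubmodule (Fin 3) ℝ (m + n) := hf
  rw [← homogeneousSubmodule_one_pow, pow_add, homogeneousSubmodule_one_pow,
    homogeneousSubmodule_one_pow] at this
  exact Submodule.mul_induction_on this (fun a ha b hb => hmul a b ha hb) hadd

/-- coordinate forms vanishing at `v`, where `l · v = 1` -/
noncomputable def lam (l v : V3) (i : Fin 3) : PolyR := X i - C (v i) * lin l

theorem lam_decomp (l v : V3) (hl : ∑ i, l i * v i = 1) (n : ℕ) : ∀ (g : PolyR),
    g.IsHomogeneous n →
    ∃ a : Fin 3 → PolyR, (∀ i, (a i).IsHomogeneous n) ∧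
      lin l * g = C (eval v g) * lin l ^ (n + 1) + ∑ i, lam l v i * a i := by
  induction n with
  | zero =>
    intro g hg
    obtain ⟨c, rfl⟩ : ∃ c, g = C c := ⟨_, (totalDegree_eq_zero_iff_eq_C.1
      ((totalDegree_zero_iff_isHomogeneous _).2 hg))⟩
    refine ⟨fun _ => 0, fun i => isHomogeneous_zero _ _ _, ?_⟩
    simp [mul_comm]
  | succ n ih =>
    intro g hg
    rw [add_comm] at hg
    refine hom_mul_ind (Pr := fun g => ∃ a : Fin 3 → PolyR, (∀ i, (a i).IsHomogeneous (n+1)) ∧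
      lin l * g = C (eval v g) * lin l ^ (n + 1 + 1) + ∑ i, lam l v i * a i) ?_ ?_ hg
    · intro p q hp hq
      obtain ⟨c, rfl⟩ := lin_exists hp
      obtain ⟨a, ha, hae⟩ := ih q hq
      refine ⟨fun i => C (c i) * (lin l * q) + C (∑ k, c k * v k) * (lin l * a i), ?_, ?_⟩
      · intro i
        refine IsHomogeneous.add ?_ ?_
        · refine IsHomogeneous.C_mul ?_ _
          rw [add_comm]; exact (lin_hom l).mul hq
        · refine IsHomogeneous.C_mul ?_ _
          rw [add_comm]; exact (lin_hom l).mul (ha i)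
      · have h1 : lin c = ∑ i, C (c i) * lam l v i + C (∑ k, c k * v k) * lin l := by
          simp only [lam, lin, Fin.sum_univ_three, map_add, map_mul]
          ring
        rw [map_mul, eval_lin]
        have : lin l * (lin c * q) = (∑ i, C (c i) * lam l v i) * (lin l * q) +
            C (∑ k, c k * v k) * lin l * (lin l * q) := by
          rw [h1]; ring
        rw [this]
        simp only [Fin.sum_univ_three] at hae ⊢
        linear_combination (C (c 0 * v 0 + c 1 * v 1 + c 2 * v 2) * lin l) * hae +
          (lin l ^ (n + 2)) *
            (C_mul (σ := Fin 3) (a := c 0 * v 0 + c 1 * v 1 + c 2 * v 2) (a' := eval v q)).symm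
    · rintro p q ⟨a, ha, hae⟩ ⟨b, hb, hbe⟩
      refine ⟨fun i => a i + b i, fun i => (ha i).add (hb i), ?_⟩
      rw [mul_add, hae, hbe]
      simp only [map_add, Fin.sum_univ_three]
      ring

section PartC
variable {ι : Type} [Fintype ι] [DecidableEq ι] (v : ι → V3) (l : V3)
  (hl : ∀ i, ∑ k, l k * v i k = 1) (s : ι → PolyR) (hs : ∀ i, (s i).IsHomogeneous 17)
  (hss : ∀ i j, eval (v j) (s i) = if i = j then 1 else 0)

noncomputable def II : Ideal PolyR := ⨅ i, pointIdeal (v i)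

omit [Fintype ι] [DecidableEq ι] in
theorem mem_II {f : PolyR} {n : ℕ} (hf : f.IsHomogeneous n) (h : ∀ i, eval (v i) f = 0) :
    f ∈ II v := by
  rw [II, Ideal.mem_iInf]
  exact fun i => mem_pi_of_hom hf (h i)

omit [Fintype ι] [DecidableEq ι] in
theorem eval_II {f : PolyR} (hf : f ∈ II v) (i : ι) : eval (v i) f = 0 := by
  rw [II, Ideal.mem_iInf] at hf
  exact eval_of_mem_pi (hf i)

include hs hss in
omit [Fintype ι] in
theorem lin_s_mem (P : ι) (m : V3) (hm : ∑ k, m k * v P k = 0) : lin m * s P ∈ II v := by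
  refine mem_II v ((lin_hom m).mul (hs P)) fun j => ?_
  rw [map_mul, hss, eval_lin]
  split_ifs with h
  · subst h; rw [hm, zero_mul]
  · rw [mul_zero]

include hl hss in
omit [Fintype ι] in
theorem exists_nu {P Q : ι} (h : P ≠ Q) :
    ∃ n : V3, ∑ k, n k * v P k = 0 ∧ ∑ k, n k * v Q k = 1 := by
  have hne : v P ≠ v Q := by
    intro hv
    have h1 := hss P P
    have h2 := hss P Q
    rw [← hv, h1] at h2
    simp [h] at h2
  obtain ⟨i, hi⟩ : ∃ i, v P i ≠ v Q i := by
    by_contra hc; push Not at hc; exact hne (funext hc)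
  have hi' : v Q i - v P i ≠ 0 := sub_ne_zero.2 (Ne.symm hi)
  refine ⟨fun k => ((if k = i then 1 else 0) - v P i * l k) / (v Q i - v P i), ?_, ?_⟩
  · have : ∀ k, ((if k = i then 1 else 0) - v P i * l k) / (v Q i - v P i) * v P k =
      ((if k = i then v P k else 0) - v P i * (l k * v P k)) / (v Q i - v P i) := by
      intro k; split_ifs <;> ring
    simp only [this]
    rw [← Finset.sum_div, Finset.sum_sub_distrib, ← Finset.mul_sum, hl]
    simp
  · have : ∀ k, ((if k = i then 1 else 0) - v P i * l k) / (v Q i - v P i) * v Q k =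
      ((if k = i then v Q k else 0) - v P i * (l k * v Q k)) / (v Q i - v P i) := by
      intro k; split_ifs <;> ring
    simp only [this]
    rw [← Finset.sum_div, Finset.sum_sub_distrib, ← Finset.mul_sum, hl]
    simp [hi']

include hl hs hss in
omit [Fintype ι] in
theorem mu_lemma {P Q : ι} (h : P ≠ Q) (m : V3) (h1 : ∑ k, m k * v P k = 0)
    (h2 : ∑ k, m k * v Q k = 0) : s P * lin l * (s Q * lin m) ∈ II v ^ 2 := by
  obtain ⟨n, hn1, hn2⟩ := exists_nu v l hl s hss h
  have e : s P * lin l * (s Q * lin m) =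
      (lin m * s P) * (lin (fun k => l k - n k) * s Q) + (lin n * s P) * (lin m * s Q) := by
    have : lin (fun k => l k - n k) = lin l - lin n := by
      simp only [lin, Fin.sum_univ_three, map_sub]; ring
    rw [this]; ring
  rw [e, pow_two]
  refine add_mem (Ideal.mul_mem_mul ?_ ?_) (Ideal.mul_mem_mul ?_ ?_)
  · exact lin_s_mem v s hs hss _ _ h1
  · refine lin_s_mem v s hs hss _ _ ?_
    simp only [sub_mul, Finset.sum_sub_distrib, hl, hn2, sub_self]
  · exact lin_s_mem v s hs hss _ _ hn1
  · exact lin_s_mem v s hs hss _ _ h2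

theorem lam_eq (l v : V3) (i : Fin 3) :
    lam l v i = lin (fun k => (if k = i then 1 else 0) - v i * l k) := by
  fin_cases i <;> simp [lam, lin, Fin.sum_univ_three] <;> ring

include hl hs hss in
theorem key_lemma (P : ι) {g : PolyR} {n : ℕ} (hn : 18 ≤ n) (hg : g.IsHomogeneous n)
    (hgI : g ∈ II v) (hd : ∀ j, eval (v P) (pderiv j g) = 0) : s P * lin l * g ∈ II v ^ 2 := by
  obtain ⟨a, ha, hae⟩ := lam_decomp l (v P) (hl P) n g hg
  rw [eval_II v hgI, map_zero, zero_mul, zero_add] at hae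
  set h : Fin 3 → PolyR := fun i =>
    a i - ∑ Q, C (eval (v Q) (a i)) * (s Q * lin l ^ (n - 17)) with hh
  have hhI : ∀ i, h i ∈ II v := by
    intro i
    refine mem_II v (n := n) ?_ ?_
    · refine (ha i).sub (IsHomogeneous.sum _ _ _ fun Q _ => IsHomogeneous.C_mul ?_ _)
      have := (hs Q).mul ((lin_hom l).pow (n - 17))
      rwa [show 17 + 1 * (n - 17) = n by omega] at this
    · intro j
      simp only [hh, map_sub, map_sum, map_mul, eval_C, hss, map_pow, eval_lin, hl]
      simp
  let mv : ι → V3 := fun Q k => ∑ i, ((if k = i then 1 else 0) - v P i * l k) * eval (v Q) (a i)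
  have hmv : ∀ Q, lin (mv Q) = ∑ i, lam l (v P) i * C (eval (v Q) (a i)) := by
    intro Q
    simp only [lam_eq]
    simp only [mv, lin, Fin.sum_univ_three, map_add, map_mul, map_sub]
    ring
  have hmP : mv P = 0 := by
    funext j
    have h1 := congrArg (fun p => eval (v P) (pderiv j p)) hae
    have hlam0 : ∀ i, eval (v P) (lam l (v P) i) = 0 := by
      intro i; simp [lam, eval_lin, hl]
    simp only [Derivation.leibniz, map_add, map_sum, smul_eq_mul, map_mul, hd, eval_II v hgI,
      hlam0, mul_zero, zero_mul, zero_add, add_zero] at h1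
    simp only [lam_eq, pderiv_lin, eval_C] at h1
    simp only [mv, Pi.zero_apply]
    refine Eq.trans ?_ h1.symm
    exact Finset.sum_congr rfl fun i _ => mul_comm _ _
  have e : s P * lin l * g = ∑ i, (lam l (v P) i * s P) * h i +
      ∑ Q, lin l ^ (n - 18) * (s P * lin l * (s Q * lin (mv Q))) := by
    rw [mul_assoc, hae]
    simp only [hmv, hh]
    have hp : lin l ^ (n - 17) = lin l ^ (n - 18) * lin l := by
      rw [← pow_succ]; congr 1; omega
    rw [hp]
    simp only [Fin.sum_univ_three, mul_sub, Finset.mul_sum]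
    have : ∀ Q, lin l ^ (n - 18) * (s P * lin l * (s Q * (lam l (v P) 0 * C (eval (v Q) (a 0)) +
        lam l (v P) 1 * C (eval (v Q) (a 1)) + lam l (v P) 2 * C (eval (v Q) (a 2))))) =
        lam l (v P) 0 * s P * (C (eval (v Q) (a 0)) * (s Q * (lin l ^ (n - 18) * lin l))) +
        lam l (v P) 1 * s P * (C (eval (v Q) (a 1)) * (s Q * (lin l ^ (n - 18) * lin l))) +
        lam l (v P) 2 * s P * (C (eval (v Q) (a 2)) * (s Q * (lin l ^ (n - 18) * lin l))) := by
      intro Q; ring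
    simp only [this, Finset.sum_add_distrib]
    ring
  rw [e]
  refine add_mem (sum_mem fun i _ => ?_) (sum_mem fun Q _ => ?_)
  · rw [pow_two]
    refine Ideal.mul_mem_mul ?_ (hhI i)
    rw [lam_eq]
    refine lin_s_mem v s hs hss _ _ ?_
    have := hl P
    have h2 : ∀ k, ((if k = i then 1 else 0) - v P i * l k) * v P k =
      (if k = i then v P k else 0) - v P i * (l k * v P k) := by
      intro k; split_ifs <;> ring
    simp only [h2, Finset.sum_sub_distrib, ← Finset.mul_sum, hl]
    simp
  · refine Ideal.mul_mem_left _ _ ?_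
    by_cases hPQ : P = Q
    · subst hPQ
      rw [hmP]
      have : lin 0 = 0 := by simp [lin]
      rw [this]; simp
    · refine mu_lemma v l hl s hs hss hPQ _ ?_ ?_
      · have h2 := congrArg (eval (v P)) (hmv Q)
        rw [eval_lin] at h2
        rw [h2]
        simp [lam, eval_lin, hl]
      · have h2 := congrArg (eval (v Q)) (hmv Q)
        rw [eval_lin] at h2
        rw [h2]
        have h3 := congrArg (eval (v Q)) hae
        simp only [map_mul, eval_II v hgI, mul_zero, map_sum] at h3
        simp only [map_mul, map_sum, eval_C]
        exact h3.symm

def PrC (n : ℕ) (f : PolyR) : Prop := ∃ g : ι → PolyR, ∃ r : ι → ℝ,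
  (∀ P, (g P).IsHomogeneous n) ∧ (∀ P, g P ∈ II v) ∧
  f - (∑ P, s P * lin l * g P + ∑ P, C (r P) * ((s P * lin l) ^ 2 * lin l ^ (n - 18)))
        ∈ II v ^ 2

omit [DecidableEq ι] in
theorem PrC_add {n : ℕ} {p q : PolyR} (hp : PrC v l s n p) (hq : PrC v l s n q) :
    PrC v l s n (p + q) := by
  obtain ⟨g, r, hg, hgI, hgr⟩ := hp
  obtain ⟨g', r', hg', hgI', hgr'⟩ := hq
  refine ⟨fun P => g P + g' P, fun P => r P + r' P, fun P => (hg P).add (hg' P),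
    fun P => add_mem (hgI P) (hgI' P), ?_⟩
  convert add_mem hgr hgr' using 1
  simp only [mul_add, map_add, add_mul, Finset.sum_add_distrib]
  ring

omit [DecidableEq ι] in
theorem PrC_sq {n : ℕ} {p : PolyR} (hp : p ∈ II v ^ 2) : PrC v l s n p :=
  ⟨fun _ => 0, fun _ => 0, fun _ => isHomogeneous_zero _ _ _, fun _ => zero_mem _, by simpa using hp⟩

omit [DecidableEq ι] in
theorem PrC_sum {n : ℕ} {κ : Type} (t : Finset κ) (p : κ → PolyR) (h : ∀ i ∈ t, PrC v l s n (p i)) :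
    PrC v l s n (∑ i ∈ t, p i) := by
  classical
  exact Finset.sum_induction p (PrC v l s n) (fun _ _ => PrC_add v l s)
    (PrC_sq v l s (zero_mem _)) h

theorem PrC_g {n : ℕ} (P : ι) {g : PolyR} (hg : g.IsHomogeneous n) (hgI : g ∈ II v) :
    PrC v l s n (s P * lin l * g) := by
  refine ⟨fun Q => if Q = P then g else 0, fun _ => 0, ?_, ?_, ?_⟩
  · intro Q; dsimp only; split_ifs
    · exact hg
    · exact isHomogeneous_zero _ _ _
  · intro Q; dsimp only; split_ifs
    · exact hgI
    · exact zero_mem _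
  · simp

theorem PrC_r {n : ℕ} (P : ι) (r : ℝ) :
    PrC v l s n (C r * ((s P * lin l) ^ 2 * lin l ^ (n - 18))) := by
  refine ⟨fun Q => 0, fun Q => if Q = P then r else 0, fun _ => isHomogeneous_zero _ _ _,
    fun _ => zero_mem _, ?_⟩
  have : ∀ Q, (C (if Q = P then r else 0) : PolyR) = if Q = P then C r else 0 := by
    intro Q; split_ifs <;> simp
  simp [this]

include hl hs hss in
theorem PrC_mul {n : ℕ} (hn : 18 ≤ n) {p q : PolyR} (hp : p.IsHomogeneous 18)
    (hq : q.IsHomogeneous n) : PrC v l s n (p * q) := by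
  set ip : PolyR := p - ∑ P, C (eval (v P) p) * (s P * lin l) with hip
  set iq : PolyR := q - ∑ P, C (eval (v P) q) * (s P * lin l * lin l ^ (n - 18)) with hiq
  have he : ∀ P, (s P * lin l).IsHomogeneous 18 := fun P => (hs P).mul (lin_hom l)
  have he' : ∀ {x : PolyR}, x.IsHomogeneous 18 → (x * lin l ^ (n - 18)).IsHomogeneous n := by
    intro x hx
    have := hx.mul ((lin_hom l).pow (n - 18))
    rwa [show 18 + 1 * (n - 18) = n by omega] at this
  have hiph : ip.IsHomogeneous 18 :=
    hp.sub (IsHomogeneous.sum _ _ _ fun P _ => (he P).C_mul _)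
  have hiqh : iq.IsHomogeneous n :=
    hq.sub (IsHomogeneous.sum _ _ _ fun P _ => (he' (he P)).C_mul _)
  have hipI : ip ∈ II v := by
    refine mem_II v hiph fun j => ?_
    simp only [hip, map_sub, map_sum, map_mul, eval_C, hss, eval_lin, hl]
    simp
  have hiqI : iq ∈ II v := by
    refine mem_II v hiqh fun j => ?_
    simp only [hiq, map_sub, map_sum, map_mul, eval_C, hss, eval_lin, hl, map_pow]
    simp
  have hpe : p = ip + ∑ P, C (eval (v P) p) * (s P * lin l) := by rw [hip]; ring
  have hqe : q = iq + ∑ P, C (eval (v P) q) * (s P * lin l * lin l ^ (n - 18)) := by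
    rw [hiq]; ring
  have e : p * q = ip * iq + ∑ P, s P * lin l * (C (eval (v P) p) * iq) +
      ∑ P, s P * lin l * (C (eval (v P) q) * (ip * lin l ^ (n - 18))) +
      ∑ P, ∑ Q, C (eval (v P) p * eval (v Q) q) * (s P * lin l * (s Q * lin l) *
        lin l ^ (n - 18)) := by
    conv_lhs => rw [hpe, hqe]
    have e1 : ∑ P, s P * lin l * (C (eval (v P) p) * iq) =
        (∑ P, C (eval (v P) p) * (s P * lin l)) * iq := by
      rw [Finset.sum_mul]; exact Finset.sum_congr rfl fun _ _ => by ring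
    have e2 : ∑ P, s P * lin l * (C (eval (v P) q) * (ip * lin l ^ (n - 18))) =
        ip * ∑ P, C (eval (v P) q) * (s P * lin l * lin l ^ (n - 18)) := by
      rw [Finset.mul_sum]; exact Finset.sum_congr rfl fun _ _ => by ring
    have e3 : ∑ P, ∑ Q, C (eval (v P) p * eval (v Q) q) * (s P * lin l * (s Q * lin l) *
        lin l ^ (n - 18)) = (∑ P, C (eval (v P) p) * (s P * lin l)) *
        ∑ P, C (eval (v P) q) * (s P * lin l * lin l ^ (n - 18)) := by
      rw [Finset.sum_mul_sum]
      exact Finset.sum_congr rfl fun _ _ => Finset.sum_congr rfl fun _ _ => by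
        rw [map_mul]; ring
    rw [e1, e2, e3]
    generalize (∑ P, C (eval (v P) p) * (s P * lin l)) = A
    generalize ∑ P, C (eval (v P) q) * (s P * lin l * lin l ^ (n - 18)) = B
    ring
  rw [e]
  refine PrC_add v l s (PrC_add v l s (PrC_add v l s ?_ ?_) ?_) ?_
  · refine PrC_sq v l s ?_
    rw [pow_two]; exact Ideal.mul_mem_mul hipI hiqI
  · exact PrC_sum v l s _ _ fun P _ => PrC_g v l s P (hiqh.C_mul _) (Ideal.mul_mem_left _ _ hiqI)
  · exact PrC_sum v l s _ _ fun P _ => PrC_g v l s P ((he' hiph).C_mul _)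
      (Ideal.mul_mem_left _ _ (Ideal.mul_mem_right _ _ hipI))
  · refine PrC_sum v l s _ _ fun P _ => PrC_sum v l s _ _ fun Q _ => ?_
    by_cases hPQ : P = Q
    · subst hPQ
      have := PrC_r v l s (n := n) P (eval (v P) p * eval (v P) q)
      rwa [pow_two] at this
    · obtain ⟨m, hm1, hm2⟩ := exists_nu v l hl s hss hPQ
      have hl' : lin (fun k => l k - m k) = lin l - lin m := by
        simp only [lin, Fin.sum_univ_three, map_sub]; ring
      have h1 : lin (fun k => l k - m k) * s Q ∈ II v := by
        refine lin_s_mem v s hs hss _ _ ?_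
        simp only [sub_mul, Finset.sum_sub_distrib, hl, hm2, sub_self]
      have h2 : lin m * s P ∈ II v := lin_s_mem v s hs hss _ _ hm1
      have e2 : C (eval (v P) p * eval (v Q) q) * (s P * lin l * (s Q * lin l) *
          lin l ^ (n - 18)) =
          s P * lin l * (C (eval (v P) p * eval (v Q) q) *
            (lin (fun k => l k - m k) * s Q * lin l ^ (n - 18))) +
          s Q * lin l * (C (eval (v P) p * eval (v Q) q) *
            (lin m * s P * lin l ^ (n - 18))) := by
        rw [hl']; ring
      rw [e2]
      refine PrC_add v l s ?_ ?_
      · exact PrC_g v l s P ((he' ((lin_hom _).mul (hs Q))).C_mul _)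
          (Ideal.mul_mem_left _ _ (Ideal.mul_mem_right _ _ h1))
      · exact PrC_g v l s Q ((he' ((lin_hom _).mul (hs P))).C_mul _)
          (Ideal.mul_mem_left _ _ (Ideal.mul_mem_right _ _ h2))

include hl hs hss in
theorem partC {f : PolyR} {d : ℕ} (hd : 36 ≤ d) (hf : f.IsHomogeneous d)
    (h1 : ∀ i, eval (v i) f = 0) (h2 : ∀ i j, eval (v i) (pderiv j f) = 0) : f ∈ II v ^ 2 := by
  obtain ⟨n, rfl, hn⟩ : ∃ n, d = 18 + n ∧ 18 ≤ n := ⟨d - 18, by omega, by omega⟩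
  have hdec : PrC v l s n f :=
    hom_mul_ind (fun p q hp hq => PrC_mul v l hl s hs hss hn hp hq)
      (fun p q => PrC_add v l s) hf
  obtain ⟨g, r, hg, hgI, hgr⟩ := hdec
  have hsub : II v ^ 2 ≤ II v := by rw [pow_two]; exact Ideal.mul_le_left
  have hr : ∀ P, r P = 0 := by
    intro P
    have := eval_II v (hsub hgr) P
    simp only [map_sub, map_add, map_sum, map_mul, map_pow, h1, hss, eval_lin, hl,
      eval_II v (hgI _), eval_C] at this
    simpa using this
  have hr' : ∑ P, C (r P) * ((s P * lin l) ^ 2 * lin l ^ (n - 18)) = 0 := by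
    simp [hr]
  rw [hr', add_zero] at hgr
  have hsq : ∀ P, II v ^ 2 ≤ pointIdeal (v P) ^ 2 := fun P =>
    Ideal.pow_right_mono (iInf_le _ P) 2
  have hgd : ∀ P j, eval (v P) (pderiv j (g P)) = 0 := by
    intro P j
    have := pderiv_sq (hsq P hgr) j
    simp only [map_sub, map_sum, Derivation.leibniz, smul_eq_mul, map_add, map_mul, h2, hss,
      eval_II v (hgI _), eval_lin, hl] at this
    simpa using this
  have := add_mem hgr (sum_mem fun P (_ : P ∈ Finset.univ) =>
    key_lemma v l hl s hs hss P hn (hg P) (hgI P) (hgd P))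
  simpa using this

end PartC

/-! ### integer data -/

abbrev T3 := ℤ × ℤ × ℤ

def dt (a b : T3) : ℤ := a.1 * b.1 + a.2.1 * b.2.1 + a.2.2 * b.2.2

def cr (a b : T3) : T3 :=
  (a.2.1 * b.2.2 - a.2.2 * b.2.1, a.2.2 * b.1 - a.1 * b.2.2, a.1 * b.2.1 - a.2.1 * b.1)

noncomputable def rv (a : T3) : V3 := ![(a.1 : ℝ), (a.2.1 : ℝ), (a.2.2 : ℝ)]

theorem dot_rv (a b : T3) : ∑ k, rv a k * rv b k = (dt a b : ℝ) := by
  simp [rv, Fin.sum_univ_three, dt]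

theorem eval_lin_rv (a b : T3) : eval (rv b) (lin (rv a)) = (dt a b : ℝ) := by
  rw [eval_lin, dot_rv]

theorem dt_self_ne {a : T3} (h : a ≠ (0, 0, 0)) : dt a a ≠ 0 := by
  obtain ⟨x, y, z⟩ := a
  intro h0
  simp only [dt] at h0
  apply h
  have hx : x = 0 := by nlinarith [mul_self_nonneg x, mul_self_nonneg y, mul_self_nonneg z]
  have hy : y = 0 := by nlinarith [mul_self_nonneg x, mul_self_nonneg y, mul_self_nonneg z]
  have hz : z = 0 := by nlinarith [mul_self_nonneg x, mul_self_nonneg y, mul_self_nonneg z]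
  rw [hx, hy, hz]

def Ev (Z : List T3) (e : ℕ) : Prop := ∀ p ∈ Z, ∃ s : PolyR, s.IsHomogeneous e ∧
  eval (rv p) s ≠ 0 ∧ ∀ q ∈ Z, q ≠ p → eval (rv q) s = 0

theorem sep_line (p : T3) (hp : p ≠ (0, 0, 0)) (k : ℕ) : ∀ (Z : List T3),
    (∀ q ∈ Z, cr p q ≠ (0, 0, 0)) → Z.length ≤ k →
    ∃ t : PolyR, t.IsHomogeneous k ∧ eval (rv p) t ≠ 0 ∧ ∀ q ∈ Z, eval (rv q) t = 0 := by
  induction k with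
  | zero =>
    intro Z _ hZ
    refine ⟨1, isHomogeneous_one _ _, by simp, ?_⟩
    have : Z = [] := List.length_eq_zero_iff.1 (by omega)
    simp [this]
  | succ k ih =>
    intro Z hZ hlen
    cases Z with
    | nil =>
      obtain ⟨t, h1, h2, _⟩ := ih [] (by simp) (by simp)
      refine ⟨t * lin (rv p), h1.mul (lin_hom _), ?_, by simp⟩
      rw [map_mul, eval_lin_rv]
      exact mul_ne_zero h2 (by exact_mod_cast dt_self_ne hp)
    | cons q Z =>
      obtain ⟨t, h1, h2, h3⟩ := ih Z (fun q hq => hZ q (List.mem_cons_of_mem _ hq))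
        (by simpa using hlen)
      refine ⟨t * lin (rv (cr q (cr p q))), h1.mul (lin_hom _), ?_, ?_⟩
      · rw [map_mul, eval_lin_rv]
        refine mul_ne_zero h2 ?_
        have e : dt (cr q (cr p q)) p = dt (cr p q) (cr p q) := by
          simp only [dt, cr]; ring
        rw [e]
        exact_mod_cast dt_self_ne (hZ q (by simp))
      · intro q' hq'
        rw [map_mul, eval_lin_rv]
        rcases List.mem_cons.1 hq' with rfl | h
        · have e : dt (cr q' (cr p q')) q' = 0 := by
            simp only [dt, cr]; ring
          rw [e]; simp
        · rw [h3 _ h, zero_mul]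

def chkA : List T3 → List T3 → ℕ → Bool
  | [], Z, _ => Z.isEmpty
  | _ :: _, _, 0 => false
  | L :: Ls, Z, e + 1 => decide ((Z.filter fun w => dt L w == 0).length ≤ e + 2) &&
      chkA Ls (Z.filter fun w => dt L w != 0) e

theorem chkA_ev : ∀ (Ls Z : List T3) (e : ℕ), (∀ p ∈ Z, p ≠ (0, 0, 0)) →
    (∀ p ∈ Z, ∀ q ∈ Z, q ≠ p → cr p q ≠ (0, 0, 0)) → chkA Ls Z e = true → Ev Z e := by
  intro Ls
  induction Ls with
  | nil =>
    intro Z e _ _ h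
    simp only [chkA, List.isEmpty_iff] at h
    intro p hp
    simp [h] at hp
  | cons L Ls ih =>
    intro Z e h0 hN h
    cases e with
    | zero => simp [chkA] at h
    | succ e =>
      simp only [chkA, Bool.and_eq_true, decide_eq_true_eq] at h
      obtain ⟨hlen, hrec⟩ := h
      set Z2 := Z.filter fun w => dt L w != 0 with hZ2
      have hsub : ∀ p, p ∈ Z2 ↔ p ∈ Z ∧ dt L p ≠ 0 := by intro p; simp [hZ2]
      have ev2 : Ev Z2 e := ih Z2 e (fun p hp => h0 p ((hsub p).1 hp).1)
        (fun p hp q hq => hN p ((hsub p).1 hp).1 q ((hsub q).1 hq).1) hrec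
      intro p hp
      by_cases hLp : dt L p = 0
      · obtain ⟨t, ht1, ht2, ht3⟩ := sep_line p (h0 p hp) (e + 1)
          ((Z.filter fun w => dt L w == 0).filter fun w => w ≠ p) (by
            intro q hq
            simp only [List.mem_filter, decide_eq_true_eq] at hq
            exact hN p hp q hq.1.1 hq.2) (by
            have : ((Z.filter fun w => dt L w == 0).filter fun w => w ≠ p).length <
                (Z.filter fun w => dt L w == 0).length := by
              rw [List.length_filter_lt_length_iff_exists]
              exact ⟨p, by simp [hp, hLp], by simp⟩
            omega)
        choose! σ hσ1 hσ2 hσ3 using ev2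
        refine ⟨t - ∑ q ∈ Z2.toFinset, C (eval (rv q) t / ((dt L q : ℝ) * eval (rv q) (σ q))) *
          (lin (rv L) * σ q), ?_, ?_, ?_⟩
        · refine ht1.sub (IsHomogeneous.sum _ _ _ fun q hq => IsHomogeneous.C_mul ?_ _)
          rw [add_comm]
          exact (lin_hom _).mul (hσ1 q (List.mem_toFinset.1 hq))
        · simp only [map_sub, map_sum, map_mul, eval_lin_rv, hLp]
          simpa using ht2
        · intro q hq hqp
          by_cases hLq : dt L q = 0
          · simp only [map_sub, map_sum, map_mul, eval_lin_rv, hLq]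
            simpa using ht3 q (by simp [hq, hLq, hqp])
          · have hq2 : q ∈ Z2 := (hsub q).2 ⟨hq, hLq⟩
            rw [map_sub, map_sum, Finset.sum_eq_single q]
            · rw [map_mul, eval_C, map_mul, eval_lin_rv]
              have : ((dt L q : ℝ) * eval (rv q) (σ q)) ≠ 0 :=
                mul_ne_zero (by exact_mod_cast hLq) (hσ2 q hq2)
              rw [div_mul_cancel₀ _ this, sub_self]
            · intro r hr hrq
              rw [map_mul, map_mul, hσ3 r (List.mem_toFinset.1 hr) q hq2 (Ne.symm hrq)]
              simp
            · intro h; exact absurd (List.mem_toFinset.2 hq2) h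
      · obtain ⟨t, ht1, ht2, ht3⟩ := ev2 p ((hsub p).2 ⟨hp, hLp⟩)
        refine ⟨t * lin (rv L), ht1.mul (lin_hom _), ?_, ?_⟩
        · rw [map_mul, eval_lin_rv]
          exact mul_ne_zero ht2 (by exact_mod_cast hLp)
        · intro q hq hqp
          rw [map_mul, eval_lin_rv]
          by_cases hLq : dt L q = 0
          · simp [hLq]
          · rw [ht3 q ((hsub q).2 ⟨hq, hLq⟩) hqp, zero_mul]

/-! ### Bezout -/

noncomputable def Phi (p q : V3) : PolyR →ₐ[ℝ] Polynomial ℝ :=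
  aeval fun i => Polynomial.C (p i) + Polynomial.C (q i) * Polynomial.X

theorem eval_Phi (p q : V3) (t : ℝ) (f : PolyR) :
    Polynomial.eval t (Phi p q f) = eval (p + t • q) f := by
  have : (Polynomial.evalRingHom t).comp (Phi p q : PolyR →+* Polynomial ℝ) =
      (eval (p + t • q) : PolyR →+* ℝ) := by
    refine MvPolynomial.ringHom_ext ?_ ?_
    · intro r; simp [Phi]
    · intro i; simp [Phi]; ring
  exact RingHom.congr_fun this f

theorem Phi_lin (p q l : V3) : Phi p q (lin l) =
    Polynomial.C (∑ k, l k * p k) + Polynomial.C (∑ k, l k * q k) * Polynomial.X := by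
  simp only [Phi, lin, map_sum, map_mul, aeval_X, Fin.sum_univ_three, map_add, algHom_C,
    Polynomial.algebraMap_eq]
  ring

theorem Phi_deg (p q : V3) {g : PolyR} {D : ℕ} (hg : g.IsHomogeneous D) :
    (Phi p q g).natDegree ≤ D := by
  have := aeval_natDegree_le g (hg.totalDegree_le)
    (fun i => Polynomial.C (p i) + Polynomial.C (q i) * Polynomial.X) (n := 1) (by
      intro i; compute_degree)
  simpa [Phi] using this

theorem Phi_dvd (p q : V3) (t : ℝ) {f : PolyR} {m : ℕ} (h : f ∈ pointIdeal (p + t • q) ^ m) :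
    (Polynomial.X - Polynomial.C t) ^ m ∣ Phi p q f := by
  have hle : (pointIdeal (p + t • q)).map (Phi p q : PolyR →+* Polynomial ℝ) ≤
      Ideal.span {Polynomial.X - Polynomial.C t} := by
    rw [Ideal.map_le_iff_le_comap]
    intro g hg
    rw [Ideal.mem_comap, Ideal.mem_span_singleton, Polynomial.dvd_iff_isRoot]
    change Polynomial.eval t (Phi p q g) = 0
    rw [eval_Phi, eval_of_mem_pi hg]
  have h1 := Ideal.mem_map_of_mem (Phi p q : PolyR →+* Polynomial ℝ) h
  rw [Ideal.map_pow] at h1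
  have h2 := Ideal.pow_right_mono hle m h1
  rw [Ideal.span_singleton_pow, Ideal.mem_span_singleton] at h2
  exact h2

theorem strip (p q : V3) (t : ℝ) (w : V3) (hw : w = p + t • q) (g : PolyR) (cnt : T3 → Bool)
    (ds : List T3) : ∀ (N : ℕ),
    (∀ d ∈ ds, cnt d = false → ∑ k, rv d k * w k ≠ 0) →
    (∀ d ∈ ds, cnt d = true → ∑ k, rv d k * w k = 0 ∧ ∑ k, rv d k * q k ≠ 0) →
    (Polynomial.X - Polynomial.C t) ^ N ∣ Phi p q ((ds.map fun d => lin (rv d)).prod * g) →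
    (Polynomial.X - Polynomial.C t) ^ (N - ds.countP cnt) ∣ Phi p q g := by
  induction ds with
  | nil => intro N _ _ h; simpa using h
  | cons d ds ih =>
    intro N h1 h2 h
    have h1' := fun d' (hd : d' ∈ ds) => h1 d' (List.mem_cons_of_mem _ hd)
    have h2' := fun d' (hd : d' ∈ ds) => h2 d' (List.mem_cons_of_mem _ hd)
    rw [List.map_cons, List.prod_cons, mul_assoc, map_mul] at h
    have hev : ∑ k, rv d k * w k = ∑ k, rv d k * p k + t * ∑ k, rv d k * q k := by
      rw [hw]
      simp only [Fin.sum_univ_three, Pi.add_apply, Pi.smul_apply, smul_eq_mul]; ring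
    cases hc : cnt d with
    | false =>
      rw [List.countP_cons_of_neg (by simp [hc])]
      refine ih N h1' h2' ?_
      have hne := h1 d (by simp) hc
      refine IsCoprime.dvd_of_dvd_mul_left ?_ h
      refine IsCoprime.pow_left ?_
      refine (Polynomial.irreducible_X_sub_C t).coprime_iff_not_dvd.2 ?_
      rw [Polynomial.dvd_iff_isRoot, Polynomial.IsRoot, eval_Phi, ← hw, eval_lin]
      exact hne
    | true =>
      rw [List.countP_cons_of_pos hc]
      obtain ⟨e0, e1⟩ := h2 d (by simp) hc
      have hlin : Phi p q (lin (rv d)) = Polynomial.C (∑ k, rv d k * q k) *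
          (Polynomial.X - Polynomial.C t) := by
        rw [Phi_lin]
        have : ∑ k, rv d k * p k = - (t * ∑ k, rv d k * q k) := by linarith
        rw [this, map_neg, map_mul]; ring
      cases N with
      | zero => simp
      | succ N =>
        have := ih N h1' h2' (by
          rw [hlin, pow_succ', mul_assoc (Polynomial.C _), mul_left_comm] at h
          have h3 := (mul_dvd_mul_iff_left (Polynomial.X_sub_C_ne_zero t)).1 h
          have hu : IsUnit (Polynomial.C (∑ k, rv d k * q k)) :=
            Polynomial.isUnit_C.2 (isUnit_iff_ne_zero.2 e1)
          exact (IsUnit.dvd_mul_left hu).1 h3)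
        rwa [show N + 1 - (ds.countP cnt + 1) = N - ds.countP cnt by omega]

attribute [local instance] MvPolynomial.gradedAlgebra

theorem hom_factor {g h : PolyR} {D : ℕ} (L : V3) (hg : g.IsHomogeneous (D + 1))
    (e : g = lin L * h) : ∃ g' : PolyR, g'.IsHomogeneous D ∧ g = lin L * g' := by
  refine ⟨homogeneousComponent D h, homogeneousComponent_isHomogeneous _ _, ?_⟩
  have h1 := DirectSum.coe_decompose_mul_add_of_left_mem (homogeneousSubmodule (Fin 3) ℝ)
    (i := 1) (j := D) (b := h) (lin_hom L)
  rw [← e] at h1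
  have h2 : ∀ (n : ℕ) (x : PolyR), ((DirectSum.decompose (homogeneousSubmodule (Fin 3) ℝ) x n :
    homogeneousSubmodule (Fin 3) ℝ n) : PolyR) = homogeneousComponent n x := fun n x =>
    decomposition.decompose'_apply x n
  rw [h2, h2, add_comm, homogeneousComponent_eq_self hg] at h1
  exact h1

theorem dvd_of_plane (L l p q q0 : V3) (hLp : ∑ k, L k * p k = 0) (hlp : ∑ k, l k * p k = 1)
    (hq0 : ∑ k, L k * q0 k = 1)
    (hspan : ∀ v : V3, ∑ k, L k * v k = 0 → ∃ t : ℝ, v = (∑ k, l k * v k) • p + t • q)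
    {g : PolyR} {D : ℕ} (hg : g.IsHomogeneous D) (h0 : ∀ t : ℝ, eval (p + t • q) g = 0) :
    ∃ h, g = lin L * h := by
  let ψ : PolyR →ₐ[ℝ] PolyR := aeval fun j => X j - C (q0 j) * lin L
  have hψ : ∀ v f, eval v (ψ f) = eval (v - (∑ k, L k * v k) • q0) f := by
    intro v f
    have : (eval v : PolyR →+* ℝ).comp (ψ : PolyR →+* PolyR) =
        (eval (v - (∑ k, L k * v k) • q0) : PolyR →+* ℝ) := by
      refine MvPolynomial.ringHom_ext ?_ ?_
      · intro r; simp [ψ]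
      · intro i; simp [ψ, eval_lin, mul_comm]
    exact RingHom.congr_fun this f
  have hz : lin (fun k => l k - (∑ i, l i * q0 i) * L k) * ψ g = 0 := by
    refine MvPolynomial.funext fun v => ?_
    rw [map_mul, hψ, map_zero]
    set v' : V3 := v - (∑ k, L k * v k) • q0 with hv'
    have hc : eval v (lin (fun k => l k - (∑ i, l i * q0 i) * L k)) = ∑ k, l k * v' k := by
      rw [eval_lin]
      simp only [hv', Fin.sum_univ_three, Pi.sub_apply, Pi.smul_apply, smul_eq_mul]; ring
    rw [hc]
    have hL : ∑ k, L k * v' k = 0 := by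
      simp only [hv', Fin.sum_univ_three, Pi.sub_apply, Pi.smul_apply, smul_eq_mul] at hq0 ⊢
      linear_combination (-(L 0 * v 0 + L 1 * v 1 + L 2 * v 2)) * hq0
    obtain ⟨t, ht⟩ := hspan v' hL
    set c := ∑ k, l k * v' k
    by_cases hc0 : c = 0
    · rw [hc0, zero_mul]
    · have : v' = c • (p + (t / c) • q) := by
        rw [ht, smul_add, smul_smul, mul_div_cancel₀ _ hc0]
      rw [this, hom_eval hg, h0]; simp
  have hne : lin (fun k => l k - (∑ i, l i * q0 i) * L k) ≠ 0 := by
    intro h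
    have := congrArg (eval p) h
    rw [eval_lin, map_zero] at this
    simp only [Fin.sum_univ_three] at this hLp hlp
    have e : (1 : ℝ) = 0 := by
      linear_combination this - hlp + (l 0 * q0 0 + l 1 * q0 1 + l 2 * q0 2) * hLp
    exact one_ne_zero e
  have hψ0 : ψ g = 0 := (mul_eq_zero.1 hz).resolve_left hne
  have hq : (Ideal.Quotient.mk (Ideal.span {lin L})).comp (ψ : PolyR →+* PolyR) =
      Ideal.Quotient.mk (Ideal.span {lin L}) := by
    refine MvPolynomial.ringHom_ext ?_ ?_
    · intro r; simp [ψ]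
    · intro i
      have : Ideal.Quotient.mk (Ideal.span {lin L}) (lin L) = 0 :=
        Ideal.Quotient.eq_zero_iff_mem.2 (Ideal.mem_span_singleton_self _)
      simp [ψ, this]
  have h1 := RingHom.congr_fun hq g
  have h2 : Ideal.Quotient.mk (Ideal.span {lin L}) g = 0 := by
    rw [← h1]
    change Ideal.Quotient.mk _ (ψ g) = 0
    rw [hψ0, map_zero]
  rw [Ideal.Quotient.eq_zero_iff_mem, Ideal.mem_span_singleton] at h2
  exact h2

def lz : T3 := (-6, 3, 1)

noncomputable def nv (w : T3) : V3 := ((dt lz w : ℝ)⁻¹) • rv w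

theorem dot_nv (a w : T3) : ∑ k, rv a k * nv w k = (dt lz w : ℝ)⁻¹ * (dt a w : ℝ) := by
  rw [← dot_rv a w]
  simp only [nv, Fin.sum_univ_three, Pi.smul_apply, smul_eq_mul]; ring

theorem rv_eq_zero {a : T3} (h : rv a = 0) : a = (0, 0, 0) := by
  obtain ⟨x, y, z⟩ := a
  have h0 := congrFun h 0
  have h1 := congrFun h 1
  have h2 := congrFun h 2
  simp [rv] at h0 h1 h2
  simp [h0, h1, h2]

theorem cross_span (a b : T3) (h : cr a b ≠ (0, 0, 0)) (x : V3) (h1 : ∑ k, rv a k * x k = 0)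
    (h2 : ∑ k, rv b k * x k = 0) : ∃ t : ℝ, x = t • rv (cr a b) := by
  have hd : (dt (cr a b) (cr a b) : ℝ) ≠ 0 := by exact_mod_cast dt_self_ne h
  refine ⟨(∑ k, rv (cr a b) k * x k) / (dt (cr a b) (cr a b) : ℝ), ?_⟩
  have key : ∀ i, (dt (cr a b) (cr a b) : ℝ) * x i = (∑ k, rv (cr a b) k * x k) * rv (cr a b) i := by
    obtain ⟨a0, a1, a2⟩ := a
    obtain ⟨b0, b1, b2⟩ := b
    simp only [rv, dt, cr, Fin.sum_univ_three, Matrix.cons_val_zero, Matrix.cons_val_one,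
      Matrix.cons_val, Int.cast_add, Int.cast_mul, Int.cast_sub] at h1 h2 ⊢
    -- q × (q-component) identities: (a×b) × x = b (a·x) - a (b·x)
    have c0 : ((a2:ℝ)*b0-a0*b2) * x 2 - (a0*b1-a1*b0) * x 1 = 0 := by
      linear_combination (b0:ℝ) * h1 - a0 * h2
    have c1 : ((a0:ℝ)*b1-a1*b0) * x 0 - (a1*b2-a2*b1) * x 2 = 0 := by
      linear_combination (b1:ℝ) * h1 - a1 * h2
    have c2 : ((a1:ℝ)*b2-a2*b1) * x 1 - (a2*b0-a0*b2) * x 0 = 0 := by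
      linear_combination (b2:ℝ) * h1 - a2 * h2
    intro i
    fin_cases i
    · simp
      linear_combination ((a0:ℝ)*b1-a1*b0) * c1 - ((a2:ℝ)*b0-a0*b2) * c2
    · simp
      linear_combination ((a1:ℝ)*b2-a2*b1) * c2 - ((a0:ℝ)*b1-a1*b0) * c0
    · simp
      linear_combination ((a2:ℝ)*b0-a0*b2) * c0 - ((a1:ℝ)*b2-a2*b1) * c1
  funext i
  rw [Pi.smul_apply, smul_eq_mul, div_mul_eq_mul_div, eq_div_iff hd, ← key i]; ring

theorem nv_inj {a b : T3} (ha : dt lz a ≠ 0) (hb : dt lz b ≠ 0) (h : nv a = nv b) :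
    cr a b = (0, 0, 0) := by
  apply rv_eq_zero
  have ha' : (dt lz a : ℝ) ≠ 0 := by exact_mod_cast ha
  have hab : rv a = ((dt lz a : ℝ) * (dt lz b : ℝ)⁻¹) • rv b := by
    rw [mul_smul]
    change rv a = (dt lz a : ℝ) • nv b
    rw [← h, nv, smul_smul, mul_inv_cancel₀ ha', one_smul]
  have h0 := congrFun hab 0
  have h1 := congrFun hab 1
  have h2 := congrFun hab 2
  generalize ((dt lz a : ℝ) * (dt lz b : ℝ)⁻¹) = c at h0 h1 h2
  simp [rv] at h0 h1 h2
  funext i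
  fin_cases i <;> simp [rv, cr, h0, h1, h2] <;> ring

theorem stepZ (L : T3) (Z : List T3) (hnd : Z.Nodup)
    (hN : ∀ p ∈ Z, ∀ q ∈ Z, q ≠ p → cr p q ≠ (0, 0, 0)) (hlz : ∀ w ∈ Z, dt lz w ≠ 0)
    (hcr : cr L lz ≠ (0, 0, 0)) {g : PolyR} {D : ℕ} (hg : g.IsHomogeneous (D + 1)) (m : T3 → ℕ)
    (hm : ∀ w ∈ Z, dt L w = 0 → ∀ (p : V3) (t : ℝ), nv w = p + t • rv (cr L lz) →
      (Polynomial.X - Polynomial.C t) ^ (m w) ∣ Phi p (rv (cr L lz)) g)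
    (hsum : D + 1 < ((Z.filter fun w => dt L w == 0).map m).sum) :
    ∃ g' : PolyR, g'.IsHomogeneous D ∧ g = lin (rv L) * g' := by
  set Z1 := Z.filter fun w => dt L w == 0 with hZ1
  have hmem : ∀ w, w ∈ Z1 ↔ w ∈ Z ∧ dt L w = 0 := by intro w; simp [hZ1]
  obtain ⟨w0, hw0⟩ : ∃ w, w ∈ Z1 := by
    rcases hE : Z1 with _ | ⟨w, _⟩
    · rw [hE] at hsum; simp at hsum
    · exact ⟨w, by simp⟩
  set p := nv w0 with hp
  set q := rv (cr L lz) with hq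
  have hw0' := (hmem w0).1 hw0
  have hl1 : ∀ w ∈ Z, ∑ k, rv lz k * nv w k = 1 := by
    intro w hw
    rw [dot_nv]
    exact inv_mul_cancel₀ (by exact_mod_cast hlz w hw)
  have hLp : ∑ k, rv L k * p k = 0 := by rw [hp, dot_nv, hw0'.2]; simp
  have hlp : ∑ k, rv lz k * p k = 1 := hl1 _ hw0'.1
  have hspan : ∀ v : V3, ∑ k, rv L k * v k = 0 →
      ∃ t : ℝ, v = (∑ k, rv lz k * v k) • p + t • q := by
    intro v hv
    obtain ⟨t, ht⟩ := cross_span L lz hcr (v - (∑ k, rv lz k * v k) • p) (by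
        simp only [Fin.sum_univ_three, Pi.sub_apply, Pi.smul_apply, smul_eq_mul] at hv hLp ⊢
        linear_combination hv - (rv lz 0 * v 0 + rv lz 1 * v 1 + rv lz 2 * v 2) * hLp) (by
        simp only [Fin.sum_univ_three, Pi.sub_apply, Pi.smul_apply, smul_eq_mul] at hlp ⊢
        linear_combination - (rv lz 0 * v 0 + rv lz 1 * v 1 + rv lz 2 * v 2) * hlp)
    exact ⟨t, by rw [← ht]; abel⟩
  have ht : ∀ w ∈ Z1, ∃ t : ℝ, nv w = p + t • q := by
    intro w hw
    obtain ⟨t, ht⟩ := hspan (nv w) (by rw [dot_nv, ((hmem w).1 hw).2]; simp)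
    rw [hl1 w ((hmem w).1 hw).1, one_smul] at ht
    exact ⟨t, ht⟩
  choose! t ht using ht
  have hdvd : ∏ w ∈ Z1.toFinset, (Polynomial.X - Polynomial.C (t w)) ^ (m w) ∣ Phi p q g := by
    refine Finset.prod_dvd_of_coprime ?_ ?_
    · intro a ha b hb hab
      refine IsCoprime.pow ?_
      refine Polynomial.isCoprime_X_sub_C_of_isUnit_sub ?_
      rw [isUnit_iff_ne_zero, sub_ne_zero]
      intro hte
      have ha' := (hmem a).1 (List.mem_toFinset.1 ha)
      have hb' := (hmem b).1 (List.mem_toFinset.1 hb)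
      refine hN a ha'.1 b hb'.1 (Ne.symm hab) (nv_inj (hlz _ ha'.1) (hlz _ hb'.1) ?_)
      rw [ht a (List.mem_toFinset.1 ha), ht b (List.mem_toFinset.1 hb), hte]
    · intro w hw
      have hw' := List.mem_toFinset.1 hw
      exact hm w ((hmem w).1 hw').1 ((hmem w).1 hw').2 p (t w) (ht w hw')
  have hdeg : (∏ w ∈ Z1.toFinset, (Polynomial.X - Polynomial.C (t w)) ^ (m w)).natDegree =
      (Z1.map m).sum := by
    rw [Polynomial.natDegree_prod_of_monic _ _ fun w _ => (Polynomial.monic_X_sub_C _).pow _]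
    simp only [Polynomial.natDegree_pow, Polynomial.natDegree_X_sub_C, mul_one]
    exact List.sum_toFinset m (hnd.filter _)
  have hPhi : Phi p q g = 0 := by
    refine Polynomial.eq_zero_of_dvd_of_natDegree_lt hdvd ?_
    rw [hdeg]
    exact lt_of_le_of_lt (Phi_deg p q hg) hsum
  have hL0 : L ≠ (0, 0, 0) := by
    rintro rfl
    apply hcr; simp [cr]
  have hLL : (dt L L : ℝ) ≠ 0 := by exact_mod_cast dt_self_ne hL0
  obtain ⟨h, hh⟩ := dvd_of_plane (rv L) (rv lz) p q ((dt L L : ℝ)⁻¹ • rv L) hLp hlp (by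
    have := dot_rv L L
    simp only [Fin.sum_univ_three, Pi.smul_apply, smul_eq_mul] at this ⊢
    rw [← inv_mul_cancel₀ hLL]
    linear_combination (dt L L : ℝ)⁻¹ * this) hspan hg (by
      intro t; rw [← eval_Phi, hPhi]; simp)
  exact hom_factor _ hg hh

/-! ### vanishing in low degree -/

def Good (Z : List T3) : Prop := Z.Nodup ∧ (∀ p ∈ Z, ∀ q ∈ Z, q ≠ p → cr p q ≠ (0, 0, 0)) ∧
  ∀ w ∈ Z, dt lz w ≠ 0

def wt (ds : List T3) (w : T3) : ℕ := 3 - ds.countP fun d => dt d w == 0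

theorem strip_nv (Z : List T3) (hZ : Good Z) {f g : PolyR} (ds : List T3)
    (hf : ∀ w ∈ Z, f ∈ pointIdeal (nv w) ^ 3)
    (e : f = (ds.map fun d => lin (rv d)).prod * g) (c : T3) (hc : ∀ d ∈ ds, dt d c ≠ 0)
    (w : T3) (hw : w ∈ Z) (p : V3) (t : ℝ) (hp : nv w = p + t • rv c) :
    (Polynomial.X - Polynomial.C t) ^ (wt ds w) ∣ Phi p (rv c) g := by
  have hlz : (dt lz w : ℝ) ≠ 0 := by exact_mod_cast hZ.2.2 w hw
  refine strip p (rv c) t (nv w) hp g _ ds 3 ?_ ?_ ?_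
  · intro d _ h
    rw [dot_nv]
    refine mul_ne_zero (inv_ne_zero hlz) ?_
    have : dt d w ≠ 0 := by simpa using h
    exact_mod_cast this
  · intro d hd h
    have : dt d w = 0 := by simpa using h
    rw [dot_nv, dot_rv, this]
    exact ⟨by simp, by exact_mod_cast hc d hd⟩
  · rw [← e]
    refine Phi_dvd _ _ _ ?_
    rw [← hp]
    exact hf w hw

def chk1 (Z : List T3) : List T3 → List T3 → ℕ → Bool
  | [], _, _ => true
  | _ :: _, _, 0 => false
  | L :: Ls, ds, D + 1 => (cr L lz != (0, 0, 0)) && (ds.all fun d => dt d (cr L lz) != 0) &&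
      decide (D + 1 < ((Z.filter fun w => dt L w == 0).map (wt ds)).sum) && chk1 Z Ls (L :: ds) D

theorem chk1_thm (Z : List T3) (hZ : Good Z) {f : PolyR} (hf : ∀ w ∈ Z, f ∈ pointIdeal (nv w) ^ 3) :
    ∀ (Ls ds : List T3) (D : ℕ) (g : PolyR), chk1 Z Ls ds D = true → g.IsHomogeneous D →
    f = (ds.map fun d => lin (rv d)).prod * g →
    ∃ g' : PolyR, g'.IsHomogeneous (D - Ls.length) ∧
      f = ((Ls.reverse ++ ds).map fun d => lin (rv d)).prod * g' := by
  intro Ls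
  induction Ls with
  | nil => intro ds D g _ hg e; exact ⟨g, hg, e⟩
  | cons L Ls ih =>
    intro ds D g h hg e
    cases D with
    | zero => simp [chk1] at h
    | succ D =>
      simp only [chk1, Bool.and_eq_true, decide_eq_true_eq, bne_iff_ne, List.all_eq_true] at h
      obtain ⟨⟨⟨h1, h2⟩, h3⟩, h4⟩ := h
      obtain ⟨g', hg', e'⟩ := stepZ L Z hZ.1 hZ.2.1 hZ.2.2 h1 hg (wt ds)
        (fun w hw _ p t hp => strip_nv Z hZ ds hf e _ h2 w hw p t hp) h3
      obtain ⟨g2, hg2, e2⟩ := ih (L :: ds) D g' h4 hg' (by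
        rw [e, e', List.map_cons, List.prod_cons]; ring)
      refine ⟨g2, ?_, ?_⟩
      · rwa [List.length_cons, Nat.add_sub_add_right]
      · rw [e2]; simp [List.append_assoc]

def chk2 : List T3 → List T3 → ℕ → Bool
  | [], Z, 0 => !Z.isEmpty
  | [], _, _ + 1 => false
  | _ :: _, _, 0 => false
  | L :: Ls, Z, D + 1 => (cr L lz != (0, 0, 0)) &&
      decide (D + 1 < (Z.filter fun w => dt L w == 0).length) &&
      chk2 Ls (Z.filter fun w => dt L w != 0) D

theorem chk2_thm : ∀ (Ls Z : List T3) (D : ℕ) (g : PolyR), Good Z → chk2 Ls Z D = true →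
    g.IsHomogeneous D → (∀ w ∈ Z, eval (nv w) g = 0) → g = 0 := by
  intro Ls
  induction Ls with
  | nil =>
    intro Z D g hZ h hg h0
    cases D with
    | succ D => simp [chk2] at h
    | zero =>
      obtain ⟨c, rfl⟩ : ∃ c, g = C c := ⟨_, (totalDegree_eq_zero_iff_eq_C.1
        ((totalDegree_zero_iff_isHomogeneous _).2 hg))⟩
      rcases Z with _ | ⟨w, Z⟩
      · simp [chk2] at h
      · have := h0 w (by simp)
        rw [eval_C] at this
        rw [this, map_zero]
  | cons L Ls ih =>
    intro Z D g hZ h hg h0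
    cases D with
    | zero => simp [chk2] at h
    | succ D =>
      simp only [chk2, Bool.and_eq_true, decide_eq_true_eq, bne_iff_ne] at h
      obtain ⟨⟨h1, h2⟩, h3⟩ := h
      obtain ⟨g', hg', e'⟩ := stepZ L Z hZ.1 hZ.2.1 hZ.2.2 h1 hg (fun _ => 1)
        (fun w hw _ p t hp => by
          rw [pow_one, Polynomial.dvd_iff_isRoot, Polynomial.IsRoot, eval_Phi, ← hp]
          exact h0 w hw) (by simpa using h2)
      have hsub : ∀ p, p ∈ (Z.filter fun w => dt L w != 0) ↔ p ∈ Z ∧ dt L p ≠ 0 := by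
        intro p; simp
      have := ih (Z.filter fun w => dt L w != 0) D g' ⟨hZ.1.filter _,
        fun p hp q hq => hZ.2.1 p ((hsub p).1 hp).1 q ((hsub q).1 hq).1,
        fun w hw => hZ.2.2 w ((hsub w).1 hw).1⟩ h3 hg' (by
          intro w hw
          obtain ⟨hw1, hw2⟩ := (hsub w).1 hw
          have h5 := h0 w hw1
          rw [e', map_mul, eval_lin, dot_nv] at h5
          refine (mul_eq_zero.1 h5).resolve_left (mul_ne_zero (inv_ne_zero ?_) ?_)
          · exact_mod_cast hZ.2.2 w hw1
          · exact_mod_cast hw2)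
      rw [e', this, mul_zero]

theorem low_zero (Z : List T3) (hZ : Good Z) (N : ℕ) (L1 L2 : List T3) (q0 : T3)
    (h1 : chk1 Z L1 [] N = true) (hq0 : ∀ d ∈ L1.reverse ++ [], dt d q0 ≠ 0)
    (h2 : chk2 L2 (Z.filter fun w => wt (L1.reverse ++ []) w != 0) (N - L1.length) = true)
    {f : PolyR} {n : ℕ} (hn : n ≤ N) (hfh : f.IsHomogeneous n)
    (hf : ∀ w ∈ Z, f ∈ pointIdeal (nv w) ^ 3) : f = 0 := by
  have hl0 : lin (rv lz) ≠ 0 := by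
    intro h
    have := congrArg (eval (rv lz)) h
    rw [eval_lin_rv, map_zero] at this
    norm_num [dt, lz] at this
  suffices h : lin (rv lz) ^ (N - n) * f = 0 from
    (mul_eq_zero.1 h).resolve_left (pow_ne_zero _ hl0)
  have hF : ∀ w ∈ Z, lin (rv lz) ^ (N - n) * f ∈ pointIdeal (nv w) ^ 3 :=
    fun w hw => Ideal.mul_mem_left _ _ (hf w hw)
  have hFh : (lin (rv lz) ^ (N - n) * f).IsHomogeneous N := by
    have := ((lin_hom (rv lz)).pow (N - n)).mul hfh
    rwa [one_mul, Nat.sub_add_cancel hn] at this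
  obtain ⟨g, hg, e⟩ := chk1_thm Z hZ hF L1 [] N _ h1 hFh (by simp)
  have hsub : ∀ p, p ∈ (Z.filter fun w => wt (L1.reverse ++ []) w != 0) ↔
      p ∈ Z ∧ wt (L1.reverse ++ []) p ≠ 0 := by
    intro p; simp
  have hg0 : g = 0 := by
    refine chk2_thm L2 _ _ g ⟨hZ.1.filter _,
        fun p hp q hq => hZ.2.1 p ((hsub p).1 hp).1 q ((hsub q).1 hq).1,
        fun w hw => hZ.2.2 w ((hsub w).1 hw).1⟩ h2 hg ?_
    intro w hw
    obtain ⟨hw1, hw2⟩ := (hsub w).1 hw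
    have h3 := strip_nv Z hZ _ hF e q0 hq0 w hw1 (nv w) 0 (by simp)
    have h4 := (dvd_pow_self (Polynomial.X - Polynomial.C (0:ℝ)) hw2).trans h3
    rw [Polynomial.dvd_iff_isRoot, Polynomial.IsRoot, eval_Phi] at h4
    simpa using h4
  rw [e, hg0, mul_zero]

/-! ### the data -/

def pts : List T3 :=
  [(-8, 3, 1), (-8, 5, 1), (-6, 1, 2), (-6, 2, 1), (-6, 3, 1), (-6, 3, 2), (-6, 4, 1),
   (-6, 5, 2), (-5, -3, 1), (-5, -1, 2), (-5, 2, 1), (-5, 3, 1), (-5, 6, 2), (-5, 8, 1),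
   (-4, -2, 1), (-4, 1, 1), (-4, 2, 1), (-4, 2, 3), (-4, 3, 1), (-4, 6, 1), (-3, -5, 1),
   (-3, -3, 1), (-3, -3, 2), (-3, -2, 1), (-3, -1, 1), (-3, 0, 1), (-3, 1, 1), (-3, 1, 2),
   (-3, 2, 1), (-3, 2, 2), (-3, 3, 1), (-3, 4, 1), (-3, 5, 1), (-3, 6, 1), (-3, 6, 2),
   (-3, 8, 1), (-2, -4, 1), (-2, -3, 1), (-2, -2, 1), (-2, -2, 3), (-2, -1, 1), (-2, -1, 2),
   (-2, 0, 1), (-2, 1, 0), (-2, 1, 1), (-2, 1, 2), (-2, 2, 1), (-2, 3, 1), (-2, 3, 2),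
   (-2, 4, 1), (-2, 4, 3), (-2, 5, 1), (-2, 6, 1), (-1, -5, 2), (-1, -3, 1), (-1, -2, 1),
   (-1, -2, 2), (-1, -1, 1), (-1, -1, 2), (-1, 0, 1), (-1, 1, 0), (-1, 1, 1), (-1, 2, 0),
   (-1, 2, 1), (-1, 2, 2), (-1, 3, 1), (-1, 3, 2), (-1, 4, 1), (-1, 6, 2), (0, -3, 1),
   (0, -2, 1), (0, -1, 1), (0, 0, 1), (0, 1, 0), (0, 1, 1), (0, 2, 1), (0, 3, 1), (1, -6, 2),
   (1, -4, 1), (1, -3, 1), (1, -3, 2), (1, -2, 1), (1, -2, 2), (1, -1, 1), (1, 0, 0), (1, 0, 1),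
   (1, 1, 0), (1, 1, 1), (1, 1, 2), (1, 2, 1), (1, 2, 2), (1, 3, 1), (1, 5, 2), (2, -6, 1),
   (2, -5, 1), (2, -4, 1), (2, -4, 3), (2, -3, 1), (2, -3, 2), (2, -2, 1), (2, -1, 1),
   (2, -1, 2), (2, 0, 1), (2, 1, 1), (2, 1, 2), (2, 2, 1), (2, 2, 3), (2, 3, 1), (2, 4, 1),
   (3, -8, 1), (3, -6, 1), (3, -6, 2), (3, -5, 1), (3, -4, 1), (3, -3, 1), (3, -2, 1),
   (3, -2, 2), (3, -1, 1), (3, -1, 2), (3, 0, 1), (3, 1, 1), (3, 2, 1), (3, 3, 1), (3, 3, 2),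
   (3, 5, 1), (4, -6, 1), (4, -3, 1), (4, -2, 1), (4, -2, 3), (4, -1, 1), (4, 2, 1), (5, -8, 1),
   (5, -6, 2), (5, -3, 1), (5, -2, 1), (5, 1, 2), (5, 3, 1), (6, -5, 2), (6, -4, 1), (6, -3, 1),
   (6, -3, 2), (6, -2, 1), (6, -1, 2), (8, -5, 1), (8, -3, 1)]

def LA : List T3 :=
  [(-1,-2,2),(2,1,2),(0,-1,3),(1,0,3),(-1,1,2),(1,1,3),(1,2,2),(1,2,0),(1,-1,2),(-2,-1,2),(-1,1,0),(2,1,0),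
   (-1,0,3),(-1,-1,3),(0,1,3)]

def L1 : List T3 :=
  [(2,1,2),(1,2,2),(1,1,3),(1,0,3),(1,-1,2),(0,1,3),(0,-1,3),(-1,1,2),(-1,0,3),(-1,-1,3),(-1,-2,2),(-2,-1,2),
   (2,1,0),(1,2,0),(-1,1,0),(1,1,2),(1,1,1),(-1,-1,2),(-1,-1,1),(1,0,2),(1,0,1),(-1,0,2),(-1,0,1),
   (0,1,2),(0,1,1),(0,-1,2),(0,-1,1)]

def L2 : List T3 :=
  [(1,1,3),(0,-1,3),(-1,0,3),(1,0,3),(0,1,3),(-1,-1,3),(3,2,0),(3,1,0)]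

set_option maxRecDepth 100000 in
theorem good_pts : Good pts := by
  refine ⟨by decide +kernel, by decide +kernel, by decide +kernel⟩

set_option maxRecDepth 100000 in
theorem pts_ne : ∀ p ∈ pts, p ≠ (0, 0, 0) := by decide +kernel

theorem ev_pts : Ev pts 17 :=
  chkA_ev LA pts 17 pts_ne good_pts.2.1 (by decide +kernel)

theorem low_pts {f : PolyR} {n : ℕ} (hn : n ≤ 35) (hfh : f.IsHomogeneous n)
    (hf : ∀ w ∈ pts, f ∈ pointIdeal (nv w) ^ 3) : f = 0 :=
  low_zero pts good_pts 35 L1 L2 (-1, -2, 4) (by decide +kernel) (by decide +kernel)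
    (by decide +kernel) hn hfh hf

theorem pointIdeal_smul {c : ℝ} (hc : c ≠ 0) (v : V3) : pointIdeal (c • v) = pointIdeal v := by
  ext f
  constructor
  · intro h a
    have := h (a * c⁻¹)
    rwa [smul_smul, mul_assoc, inv_mul_cancel₀ hc, mul_one] at this
  · intro h a
    have := h (a * c)
    rwa [← smul_smul] at this

theorem pi_hom (v : V3) : (pointIdeal v).IsHomogeneous (homogeneousSubmodule (Fin 3) ℝ) := by
  intro n f hf
  have h2 : ((DirectSum.decompose (homogeneousSubmodule (Fin 3) ℝ) f n :
    homogeneousSubmodule (Fin 3) ℝ n) : PolyR) = homogeneousComponent n f :=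
    decomposition.decompose'_apply f n
  rw [h2]
  refine mem_pi_of_hom (homogeneousComponent_isHomogeneous n f) ?_
  -- the polynomial sum of t^d f_d(v) vanishes identically
  let P : Polynomial ℝ := ∑ d ∈ Finset.range (f.totalDegree + 1),
    Polynomial.monomial d (eval v (homogeneousComponent d f))
  have hP : P = 0 := by
    refine Polynomial.funext fun t => ?_
    have h3 := hf t
    rw [← sum_homogeneousComponent f, map_sum] at h3
    simp only [P, Polynomial.eval_finsetSum, Polynomial.eval_monomial, Polynomial.eval_zero]
    rw [← h3]
    refine Finset.sum_congr rfl fun d _ => ?_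
    rw [hom_eval (homogeneousComponent_isHomogeneous d f), mul_comm]
  by_cases hn : n < f.totalDegree + 1
  · have h4 := congrArg (fun p => Polynomial.coeff p n) hP
    simp only [P, Polynomial.finsetSum_coeff, Polynomial.coeff_monomial, Polynomial.coeff_zero] at h4
    rw [Finset.sum_ite_eq' , if_pos (Finset.mem_range.2 hn)] at h4
    exact h4
  · rw [homogeneousComponent_eq_zero _ _ (by omega), map_zero]

theorem comp_mem {v : V3} {f : PolyR} (hf : f ∈ pointIdeal v ^ 3) (n : ℕ) :
    homogeneousComponent n f ∈ pointIdeal v ^ 3 := by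
  have h2 : ((DirectSum.decompose (homogeneousSubmodule (Fin 3) ℝ) f n :
    homogeneousSubmodule (Fin 3) ℝ n) : PolyR) = homogeneousComponent n f :=
    decomposition.decompose'_apply f n
  have h3 : (pointIdeal v ^ 3).IsHomogeneous (homogeneousSubmodule (Fin 3) ℝ) := by
    rw [pow_succ, pow_two]
    exact ((pi_hom v).mul (pi_hom v)).mul (pi_hom v)
  rw [← h2]
  exact h3 n hf

theorem core {f : PolyR} (hf : ∀ w ∈ pts, f ∈ pointIdeal (nv w) ^ 3) :
    f ∈ (II fun w : {w // w ∈ pts} => nv w.1) ^ 2 := by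
  choose! s hs1 hs2 hs3 using ev_pts
  rw [← sum_homogeneousComponent f]
  refine Ideal.sum_mem _ fun d _ => ?_
  have hc : ∀ w ∈ pts, homogeneousComponent d f ∈ pointIdeal (nv w) ^ 3 :=
    fun w hw => comp_mem (hf w hw) d
  have hh := homogeneousComponent_isHomogeneous d f
  by_cases hd : d ≤ 35
  · rw [low_pts hd hh hc]; exact Ideal.zero_mem _
  · have hev : ∀ p w, w ∈ pts → p ∈ pts → eval (nv w) (s p) =
        ((dt lz w : ℝ)⁻¹) ^ 17 * eval (rv w) (s p) := fun p w _ hp => hom_eval (hs1 p hp) _ _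
    have hlz : ∀ w ∈ pts, (dt lz w : ℝ) ≠ 0 := fun w hw => by exact_mod_cast good_pts.2.2 w hw
    have hnz : ∀ w ∈ pts, eval (nv w) (s w) ≠ 0 := fun w hw => by
      rw [hev w w hw hw]
      exact mul_ne_zero (pow_ne_zero _ (inv_ne_zero (hlz w hw))) (hs2 w hw)
    refine partC (fun w : {w // w ∈ pts} => nv w.1) (rv lz) ?_
      (fun w => C (eval (nv w.1) (s w.1))⁻¹ * s w.1) ?_ ?_ (by omega : 36 ≤ d) hh ?_ ?_
    · rintro ⟨w, hw⟩
      rw [dot_nv]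
      exact inv_mul_cancel₀ (hlz w hw)
    · rintro ⟨w, hw⟩
      exact (hs1 w hw).C_mul _
    · rintro ⟨w, hw⟩ ⟨w2, hw2⟩
      simp only [map_mul, eval_C, Subtype.mk.injEq]
      split_ifs with h
      · subst h
        exact inv_mul_cancel₀ (hnz w hw)
      · rw [hev w w2 hw2 hw, hs3 w hw w2 hw2 (Ne.symm h), mul_zero, mul_zero]
    · rintro ⟨w, hw⟩
      exact eval_of_mem_pi (Ideal.pow_le_self three_ne_zero (hc w hw))
    · rintro ⟨w, hw⟩ j
      exact pderiv_sq (Ideal.pow_le_pow_right (by norm_num : 2 ≤ 3) (hc w hw)) j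

/-! ### transfer to the arrangement -/

def Lf : Fin 31 → T3 :=
  ![(1, 0, 0), (1, 0, -1), (1, 0, 1), (1, 0, -2), (1, 0, 2), (1, 0, -3), (1, 0, 3),
    (1, 2, 0), (1, 2, -2), (1, 2, 2),
    (1, 1, 0), (1, 1, -1), (1, 1, 1), (1, 1, -2), (1, 1, 2), (1, 1, -3), (1, 1, 3),
    (-1, 1, 0), (-1, 1, -2), (-1, 1, 2),
    (0, 1, 0), (0, 1, -1), (0, 1, 1), (0, 1, -2), (0, 1, 2), (0, 1, -3), (0, 1, 3),
    (-2, -1, 0), (-2, -1, -2), (-2, -1, 2),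
    (0, 0, 1)]

noncomputable def kf (i : Fin 31) : ℝ :=
  if (i : ℕ) = 30 then 1 else if (i : ℕ) % 10 < 7 then u else 1 / 2

theorem u_sq : u * u = 3 / 4 := by
  have := Real.mul_self_sqrt (show (0:ℝ) ≤ 3 by norm_num)
  rw [u]; linarith

theorem u_ne : u ≠ 0 := by
  intro h
  have := u_sq
  rw [h] at this
  norm_num at this

theorem kf_ne (i : Fin 31) : kf i ≠ 0 := by
  unfold kf
  split_ifs
  · norm_num
  · exact u_ne
  · norm_num

noncomputable def TM : Matrix (Fin 3) (Fin 3) ℝ := !![u, 0, 0; 1 / 2, 1, 0; 0, 0, 1]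

noncomputable def TI : Matrix (Fin 3) (Fin 3) ℝ := !![u⁻¹, 0, 0; -(1 / 2) * u⁻¹, 1, 0; 0, 0, 1]

theorem TM_TI : TM * TI = 1 := by
  have := u_ne
  ext i j
  fin_cases i <;> fin_cases j <;> simp [TM, TI, Matrix.mul_apply, Fin.sum_univ_three, this]

theorem TI_TM : TI * TM = 1 := by
  have := u_ne
  ext i j
  fin_cases i <;> fin_cases j <;> simp [TM, TI, Matrix.mul_apply, Fin.sum_univ_three, this]

theorem eval_subst (M : Matrix (Fin 3) (Fin 3) ℝ) (v : V3) (f : PolyR) :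
    eval v (substMat M f) = eval (M.mulVec v) f := by
  have : (eval v : PolyR →+* ℝ).comp (substMat M : PolyR →+* PolyR) =
      (eval (M.mulVec v) : PolyR →+* ℝ) := by
    refine MvPolynomial.ringHom_ext ?_ ?_
    · intro r; simp [substMat]
    · intro i; simp [substMat, Matrix.mulVec, dotProduct]
  exact RingHom.congr_fun this f

theorem rot_inv : rotA⁻¹ = !![1/2, u, 0; -u, 1/2, 0; 0, 0, 1] := by
  have := u_sq
  refine Matrix.inv_eq_right_inv ?_
  ext i j
  fin_cases i <;> fin_cases j <;> simp [rotA, Matrix.mul_apply, Fin.sum_univ_three] <;> linarith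

theorem rot2_inv : (rotA ^ 2)⁻¹ = !![-1/2, u, 0; -u, -1/2, 0; 0, 0, 1] := by
  have := u_sq
  rw [← Matrix.inv_pow', rot_inv, pow_two]
  ext i j
  fin_cases i <;> fin_cases j <;> simp [Matrix.mul_apply, Fin.sum_univ_three] <;> linarith

theorem eval_lines (i : Fin 31) (x : V3) :
    eval (TM.mulVec x) (lines312 i) = kf i * ∑ k, rv (Lf i) k * x k := by
  have h := u_sq
  unfold lines312
  rw [rot_inv, rot2_inv]
  fin_cases i <;>
  simp [baseForms312, eval_subst, kf, Lf, rv, TM, Matrix.mulVec, dotProduct, Fin.sum_univ_three] <;>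
  first
  | done
  | ring1
  | linear_combination (x 0) * h
  | linear_combination (-x 0) * h

theorem pts_lines : ∀ w ∈ pts, ∃ i j, i ≠ j ∧ dt (Lf i) w = 0 ∧ dt (Lf j) w = 0 := by
  decide +kernel

theorem lines_pts : ∀ i j, i ≠ j → cr (Lf i) (Lf j) ≠ (0, 0, 0) ∧
    ∃ w ∈ pts, dt (Lf i) w = 0 ∧ dt (Lf j) w = 0 := by
  decide +kernel

theorem dot_smul (a : V3) (c : ℝ) (x : V3) : ∑ k, a k * (c • x) k = c * ∑ k, a k * x k := by
  simp only [Fin.sum_univ_three, Pi.smul_apply, smul_eq_mul]; ring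

theorem nv_ne {w : T3} (hw : w ∈ pts) : nv w ≠ 0 := by
  have hlz : (dt lz w : ℝ) ≠ 0 := by exact_mod_cast good_pts.2.2 w hw
  intro h
  rcases smul_eq_zero.1 h with h | h
  · exact inv_ne_zero hlz h
  · exact pts_ne w hw (rv_eq_zero h)

theorem T_ne {x : V3} (hx : x ≠ 0) : TM.mulVec x ≠ 0 := by
  intro h
  apply hx
  have := congrArg (TI.mulVec) h
  rwa [Matrix.mulVec_mulVec, TI_TM, Matrix.one_mulVec, Matrix.mulVec_zero] at this

theorem mem_S {w : T3} (hw : w ∈ pts) :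
    ∃ P ∈ S312, pointIdeal (Projectivization.rep P) = pointIdeal (TM.mulVec (nv w)) := by
  have h0 := T_ne (nv_ne hw)
  obtain ⟨a, ha⟩ := Projectivization.exists_smul_eq_mk_rep ℝ _ h0
  refine ⟨Projectivization.mk ℝ _ h0, ?_, ?_⟩
  · change 2 ≤ mult312 _
    obtain ⟨i, j, hij, hi, hj⟩ := pts_lines w hw
    refine Finset.one_lt_card.2 ⟨i, ?_, j, ?_, hij⟩
    all_goals
      rw [Finset.mem_filter]
      refine ⟨Finset.mem_univ _, ?_⟩
      rw [← ha, Units.smul_def, ← Matrix.mulVec_smul, eval_lines, dot_smul, dot_nv]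
    · rw [hi]; simp
    · rw [hj]; simp
  · rw [← ha, Units.smul_def]
    exact pointIdeal_smul a.ne_zero _

theorem S_mem {P : P2R} (hP : P ∈ S312) :
    ∃ w ∈ pts, ∃ c : ℝ, TI.mulVec P.rep = c • nv w := by
  change 2 ≤ mult312 _ at hP
  obtain ⟨i, hi, j, hj, hij⟩ := Finset.one_lt_card.1 hP
  rw [Finset.mem_filter] at hi hj
  obtain ⟨hc, w, hw, hwi, hwj⟩ := lines_pts i j hij
  have hrep : P.rep = TM.mulVec (TI.mulVec P.rep) := by
    rw [Matrix.mulVec_mulVec, TM_TI, Matrix.one_mulVec]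
  have hz : ∀ k, eval P.rep (lines312 k) = 0 → ∑ m, rv (Lf k) m * (TI.mulVec P.rep) m = 0 := by
    intro k hk
    rw [hrep, eval_lines] at hk
    exact (mul_eq_zero.1 hk).resolve_left (kf_ne k)
  obtain ⟨t, ht⟩ := cross_span _ _ hc _ (hz i hi.2) (hz j hj.2)
  obtain ⟨r, hr⟩ := cross_span _ _ hc (nv w) (by rw [dot_nv, hwi]; simp) (by rw [dot_nv, hwj]; simp)
  have hr0 : r ≠ 0 := by
    rintro rfl
    rw [zero_smul] at hr
    exact nv_ne hw hr
  refine ⟨w, hw, t * r⁻¹, ?_⟩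
  rw [ht, hr, smul_smul, mul_assoc, inv_mul_cancel₀ hr0, mul_one]

/-- For the ideal `I'` of the 127 intersection points of the simplicial arrangement
`A(31,2)` of 31 lines, the containment `I'^(3) = ⋂_P I(P)³ ⊆ I'²` holds. -/
theorem stmt4 :
    (⨅ P ∈ S312, (pointIdeal (Projectivization.rep P)) ^ 3) ≤
      (⨅ P ∈ S312, pointIdeal (Projectivization.rep P)) ^ 2 := by
  intro f hf
  have hf' : ∀ P ∈ S312, f ∈ pointIdeal (Projectivization.rep P) ^ 3 := by
    intro P hP
    rw [Ideal.mem_iInf] at hf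
    have := hf P
    rw [Ideal.mem_iInf] at this
    exact this hP
  have h1 : ∀ w ∈ pts, substMat TM f ∈ pointIdeal (nv w) ^ 3 := by
    intro w hw
    obtain ⟨P, hP, e⟩ := mem_S hw
    have h2 := hf' P hP
    rw [e] at h2
    have h3 := Ideal.mem_map_of_mem (substMat TM : PolyR →+* PolyR) h2
    rw [Ideal.map_pow] at h3
    refine Ideal.pow_right_mono ?_ 3 h3
    rw [Ideal.map_le_iff_le_comap]
    intro g hg c
    change eval _ (substMat TM g) = 0
    rw [eval_subst, Matrix.mulVec_smul]
    exact hg c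
  have h2 := core h1
  have h3 := Ideal.mem_map_of_mem (substMat TI : PolyR →+* PolyR) h2
  rw [Ideal.map_pow] at h3
  have h4 : (substMat TI : PolyR →+* PolyR) (substMat TM f) = f := by
    refine MvPolynomial.funext fun v => ?_
    change eval v (substMat TI (substMat TM f)) = _
    rw [eval_subst, eval_subst, Matrix.mulVec_mulVec, TM_TI, Matrix.one_mulVec]
  rw [h4] at h3
  refine Ideal.pow_right_mono ?_ 2 h3
  rw [Ideal.map_le_iff_le_comap]
  intro g hg
  rw [Ideal.mem_comap]
  refine (Ideal.mem_iInf).2 fun P => (Ideal.mem_iInf).2 fun hP => ?_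
  obtain ⟨w, hw, c, hc⟩ := S_mem hP
  intro a
  change eval _ (substMat TI g) = 0
  rw [eval_subst, Matrix.mulVec_smul, hc, smul_smul]
  rw [II, Ideal.mem_iInf] at hg
  exact hg ⟨w, hw⟩ (a * c)
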